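/- arXiv:2303.05314 — 2 statements merged into one kernel-verified Lean document; each statement's English description precedes it below -/
import Mathlib

section
/- Let k ≥ 3 and i be integers with 1 ≤ i and 2i < k, and let ℓ ≥ 2 be an integer such that for every positive integer m, ℓ(3ℓ+1) ≠ k·m² + m·(k−2i) and ℓ(3ℓ+1) ≠ k·m² − m·(k−2i). Then there exists an integer n with ℓ ≤ n ≤ ℓ(3ℓ+1)/2 such that C̄_{k,i}(n) is even. -/
/-- Andrews' singular overpartition function `C̄_{k,i}(n)`: the number of pairs `(λ, S)`
where `λ` is a partition of `n` with no part divisible by `k` and `S` is a set of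
part-values of `λ`, each congruent to `i` or `-i` modulo `k`. -/
noncomputable def singularOverpartition (k i n : ℕ) : ℕ :=
  Nat.card {P : n.Partition × Finset ℕ //
    (∀ j ∈ P.1.parts, ¬ k ∣ j) ∧
    P.2 ⊆ P.1.parts.toFinset ∧
    ∀ x ∈ P.2, (x : ZMod k) = (i : ZMod k) ∨ (x : ZMod k) = -(i : ZMod k)}

open Finset PowerSeries

/-- The Gaussian binomial coefficient `[s + r; s]` at `q`. -/
def gaussBinom {R : Type*} [CommRing R] (q : R) : ℕ → ℕ → R
  | 0, _ => 1
  | _ + 1, 0 => 1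
  | s + 1, r + 1 => gaussBinom q (s + 1) r + q ^ (r + 1) * gaussBinom q s (r + 1)

/-- The finite `q`-Pochhammer product `(q; q)_n`. -/
def qFactor {R : Type*} [CommRing R] (q : R) (n : ℕ) : R :=
  ∏ j ∈ range n, (1 - q ^ (j + 1))

section CommRing

variable {R : Type*} [CommRing R]

theorem qFactor_succ (q : R) (n : ℕ) : qFactor q (n + 1) = qFactor q n * (1 - q ^ (n + 1)) :=
  prod_range_succ _ _

theorem gaussBinom_mul_qFactor (q : R) (s r : ℕ) :
    gaussBinom q s r * (qFactor q s * qFactor q r) = qFactor q (s + r) := by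
  induction s generalizing r with
  | zero => simp [gaussBinom, qFactor]
  | succ s ihs =>
    induction r with
    | zero => simp [gaussBinom, qFactor]
    | succ r ihr =>
      have hs := ihs (r + 1)
      rw [show s + (r + 1) = s + 1 + r by ring] at hs
      rw [gaussBinom, show s + 1 + (r + 1) = (s + 1 + r) + 1 by ring, qFactor_succ q (s + 1 + r)]
      rw [qFactor_succ q s] at ihr ⊢
      rw [qFactor_succ q r] at hs ⊢
      linear_combination (1 - q ^ (r + 1)) * ihr + q ^ (r + 1) * (1 - q ^ (s + 1)) * hs

/-- The finite `q`-binomial theorem. -/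
theorem prod_add_mul_pow_eq_sum_gaussBinom (q x y : R) (n : ℕ) :
    ∏ j ∈ range n, (y + x * q ^ j) =
      ∑ p ∈ antidiagonal n, gaussBinom q p.1 p.2 * (q ^ p.1.choose 2 * x ^ p.1 * y ^ p.2) := by
  induction n with
  | zero => simp [gaussBinom]
  | succ n ih =>
    set T : ℕ × ℕ → R := fun p ↦ gaussBinom q p.1 p.2 * (q ^ p.1.choose 2 * x ^ p.1 * y ^ p.2)
      with hT
    have key : ∀ p ∈ antidiagonal (n + 1), T p =
        (if p.2 = 0 then 0 else y * T (p.1, p.2 - 1)) +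
          (if p.1 = 0 then 0 else x * q ^ n * T (p.1 - 1, p.2)) := by
      rintro ⟨s, r⟩ hp
      rw [HasAntidiagonal.mem_antidiagonal] at hp
      rcases s with _ | s <;> rcases r with _ | r
      · simp at hp
      · simp [hT, gaussBinom]
        ring
      · obtain rfl : s = n := by simpa using hp
        rcases s with _ | s
        · simp [hT, gaussBinom]
        · simp [hT, gaussBinom, Nat.choose_succ_succ' (s + 1) 1]
          ring
      · obtain rfl : n = s + (r + 1) := by simp only at hp; omega
        simp [hT, gaussBinom, Nat.choose_succ_succ' s 1]
        ring
    rw [prod_range_succ, ih, sum_congr rfl key, sum_add_distrib, Nat.sum_antidiagonal_succ',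
      Nat.sum_antidiagonal_succ]
    simp only [if_true, Nat.add_one_ne_zero, if_false, Nat.add_sub_cancel, ← mul_sum]
    ring

theorem qFactor_mul_gaussBinom_eq_one_of_pow_eq_zero {q : R} {t s r N : ℕ} (hq : q ^ (t + 1) = 0)
    (hs : t ≤ s) (hr : t ≤ r) (hN : t ≤ N) : qFactor q N * gaussBinom q s r = 1 := by
  have stable : ∀ n, t ≤ n → qFactor q n = qFactor q t := by
    intro n hn
    induction n, hn using Nat.le_induction with
    | base => rfl
    | succ n hn ih =>
      rw [qFactor_succ, ih, pow_eq_zero_of_le (by omega) hq, sub_zero, mul_one]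
  have unit : IsUnit (qFactor q t) := by
    refine (IsUnit.prod_iff).2 fun j _ ↦ IsNilpotent.isUnit_one_sub ⟨t + 1, ?_⟩
    rw [pow_right_comm, hq, zero_pow (by omega)]
  have h := gaussBinom_mul_qFactor q s r
  rw [stable s hs, stable r hr, stable (s + r) (by omega)] at h
  rw [stable N hN]
  refine unit.mul_left_cancel ?_
  linear_combination h

theorem X_pow_dvd_qFactor_mul_gaussBinom_sub_one {k t s r N : ℕ} (hk : 0 < k)
    (hs : t ≤ s) (hr : t ≤ r) (hN : t ≤ N) :
    (X : R⟦X⟧) ^ (t + 1) ∣ qFactor (X ^ k) N * gaussBinom (X ^ k) s r - 1 := by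
  set φ := Ideal.Quotient.mk (Ideal.span {(X : R⟦X⟧) ^ (t + 1)})
  have mapD : ∀ n, φ (qFactor (X ^ k) n) = qFactor (φ (X ^ k)) n := by simp [qFactor]
  have mapG : ∀ s r, φ (gaussBinom (X ^ k) s r) = gaussBinom (φ (X ^ k)) s r := by
    intro s
    induction s with
    | zero => simp [gaussBinom]
    | succ s ihs =>
      intro r
      induction r with
      | zero => simp [gaussBinom]
      | succ r ihr => simp only [gaussBinom, map_add, map_mul, map_pow, ihs, ihr]
  rw [← Ideal.mem_span_singleton, ← Ideal.Quotient.eq, map_mul, mapD, mapG, map_one]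
  refine qFactor_mul_gaussBinom_eq_one_of_pow_eq_zero ?_ hs hr hN
  rw [← map_pow, ← pow_mul, Ideal.Quotient.eq_zero_iff_mem, Ideal.mem_span_singleton]
  exact pow_dvd_pow _ (by nlinarith)

/-- The finite Jacobi triple product with `q = X ^ k` and `z = X ^ i`, with denominators cleared. -/
theorem X_pow_mul_prod_eq_sum_gaussBinom {k i : ℕ} (hik : i ≤ k) (N : ℕ) :
    (X : R⟦X⟧) ^ (k * N * N + (i * N + k * N.choose 2)) *
        ∏ j ∈ range N, ((1 + X ^ (k * j + i)) * (1 + X ^ (k * j + (k - i)))) =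
      ∑ p ∈ antidiagonal (N + N), gaussBinom (X ^ k) p.1 p.2 *
        X ^ (k * p.1.choose 2 + i * p.1 + k * N * p.2) := by
  have h := prod_add_mul_pow_eq_sum_gaussBinom ((X : R⟦X⟧) ^ k) (X ^ i) (X ^ (k * N)) (N + N)
  simp only [← pow_mul, ← pow_add] at h
  rw [← h, prod_range_add, prod_mul_distrib]
  have h1 : ∏ j ∈ range N, ((X : R⟦X⟧) ^ (k * N) + X ^ (i + k * (N + j))) =
      X ^ (k * N * N) * ∏ j ∈ range N, (1 + X ^ (k * j + i)) := by
    have e : (X : R⟦X⟧) ^ (k * N * N) = ∏ j ∈ range N, X ^ (k * N) := by simp [pow_mul]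
    rw [e, ← prod_mul_distrib]
    refine prod_congr rfl fun j _ ↦ ?_
    ring
  have h2 : ∏ j ∈ range N, ((X : R⟦X⟧) ^ (k * N) + X ^ (i + k * j)) =
      X ^ (i * N + k * N.choose 2) * ∏ j ∈ range N, (1 + X ^ (k * j + (k - i))) := by
    rw [← prod_range_reflect (fun j ↦ 1 + (X : R⟦X⟧) ^ (k * j + (k - i)))]
    have e : i * N + k * N.choose 2 = ∑ j ∈ range N, (i + k * j) := by
      rw [sum_add_distrib, ← mul_sum, sum_range_id, Nat.choose_two_right]
      simp [mul_comm]
    rw [e, ← prod_pow_eq_pow_sum, ← prod_mul_distrib]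
    refine prod_congr rfl fun j hj ↦ ?_
    obtain ⟨d, rfl⟩ := Nat.exists_eq_add_of_lt (mem_range.1 hj)
    obtain ⟨c, rfl⟩ := Nat.exists_eq_add_of_le hik
    rw [show j + d + 1 - 1 - j = d by omega, Nat.add_sub_cancel_left]
    ring
  rw [h1, h2]
  ring

theorem coeff_qFactor_mul_prod_eq_zero {k i t N : ℕ} (hi : 1 ≤ i) (hik : 2 * i < k)
    (hN : 2 * t < N)
    (h : ∀ m : ℤ, 2 * (t : ℤ) ≠ k * m ^ 2 - m * (k - 2 * i)) :
    coeff t (qFactor ((X : R⟦X⟧) ^ k) N *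
      ∏ j ∈ range N, ((1 + X ^ (k * j + i)) * (1 + X ^ (k * j + (k - i))))) = 0 := by
  set E := k * N * N + (i * N + k * N.choose 2) with hE
  rw [← coeff_X_pow_mul _ E t, mul_left_comm, X_pow_mul_prod_eq_sum_gaussBinom (by omega), mul_sum,
    map_sum]
  refine sum_eq_zero ?_
  rintro ⟨s, r⟩ hp
  rw [HasAntidiagonal.mem_antidiagonal] at hp
  simp only at hp ⊢
  set w := k * s.choose 2 + i * s + k * N * r with hw
  have choose_two : ∀ n : ℕ, 2 * (n.choose 2 : ℤ) = n * (n - 1) := by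
    intro n
    have h2 : n.choose 2 * 2 = n * (n - 1) := by
      rw [Nat.choose_two_right, Nat.div_two_mul_two_of_even (Nat.even_mul_pred_self n)]
    rcases n with _ | n
    · simp
    · rw [Nat.add_sub_cancel] at h2
      zify at h2
      push_cast
      linear_combination h2
  have hwE : 2 * (w : ℤ) - 2 * E = k * ((s : ℤ) - N) ^ 2 - ((s : ℤ) - N) * (k - 2 * i) := by
    have hr : (r : ℤ) = 2 * N - s := by omega
    rw [hw, hE]
    push_cast
    rw [hr]
    linear_combination (k : ℤ) * choose_two s - (k : ℤ) * choose_two N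
  have hne : w ≠ t + E := by
    rintro hwt
    refine h (s - N) ?_
    rw [← hwE, hwt]
    push_cast
    ring
  have hle : |(s : ℤ) - N| ≤ (w : ℤ) - E := by
    have hi' : (1 : ℤ) ≤ i := by exact_mod_cast hi
    have hik' : 2 * (i : ℤ) + 1 ≤ k := by exact_mod_cast hik
    rcases lt_trichotomy ((s : ℤ) - N) 0 with hm | hm | hm
    · rw [abs_of_neg hm]
      nlinarith [mul_pos_of_neg_of_neg hm hm]
    · rw [hm] at hwE ⊢
      simp at hwE ⊢
      omega
    · rw [abs_of_pos hm]
      nlinarith [mul_nonneg (sub_nonneg.2 (show (1 : ℤ) ≤ (s : ℤ) - N from hm))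
        (show (0 : ℤ) ≤ k * ((s : ℤ) - N) by positivity)]
  have hEw : E ≤ w := by
    have := (abs_nonneg _).trans hle
    omega
  rw [← mul_assoc, coeff_mul_X_pow']
  split_ifs with hwt
  · rw [abs_le] at hle
    obtain ⟨c, hc⟩ := X_pow_dvd_qFactor_mul_gaussBinom_sub_one (R := R) (k := k) (t := t) (s := s)
      (r := r) (N := N) (by omega) (by omega) (by omega) (by omega)
    rw [sub_eq_iff_eq_add.1 hc, map_add, coeff_X_pow_mul', if_neg (by omega), coeff_one,
      if_neg (by omega), add_zero]
  · rfl

end CommRing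

section Parity

open Classical in
theorem natCast_singularOverpartition_eq_card_restricted (k i n : ℕ) :
    (singularOverpartition k i n : ZMod 2) = #(Nat.Partition.restricted n fun a ↦
      ¬ (k ∣ a ∨ (a : ZMod k) = (i : ZMod k) ∨ (a : ZMod k) = -(i : ZMod k))) := by
  set A : n.Partition → Finset ℕ := fun p ↦ p.parts.toFinset.filter fun a ↦
    (a : ZMod k) = (i : ZMod k) ∨ (a : ZMod k) = -(i : ZMod k)
  have hfib : ∀ p : n.Partition, Nat.card {S : Finset ℕ // (∀ j ∈ p.parts, ¬ k ∣ j) ∧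
      S ⊆ p.parts.toFinset ∧
      ∀ x ∈ S, (x : ZMod k) = (i : ZMod k) ∨ (x : ZMod k) = -(i : ZMod k)} =
      if ∀ j ∈ p.parts, ¬ k ∣ j then 2 ^ #(A p) else 0 := by
    intro p
    rw [Nat.subtype_card (if ∀ j ∈ p.parts, ¬ k ∣ j then (A p).powerset else ∅)]
    · split_ifs <;> simp
    · intro S
      split_ifs with h
      · simp only [mem_powerset, A, subset_iff, mem_filter]
        grind
      · simp [h]
  have hfin : ∀ p : n.Partition, Finite {S : Finset ℕ // (∀ j ∈ p.parts, ¬ k ∣ j) ∧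
      S ⊆ p.parts.toFinset ∧
      ∀ x ∈ S, (x : ZMod k) = (i : ZMod k) ∨ (x : ZMod k) = -(i : ZMod k)} := fun p ↦
    Set.Finite.subset (p.parts.toFinset.powerset.finite_toSet) fun S hS ↦ by simpa using hS.2.1
  have hsum : singularOverpartition k i n =
      ∑ p : n.Partition, if ∀ j ∈ p.parts, ¬ k ∣ j then 2 ^ #(A p) else 0 := by
    rw [← sum_congr rfl fun p _ ↦ hfib p, ← Nat.card_sigma]
    exact Nat.card_congr (Equiv.subtypeProdEquivSigmaSubtype
      fun (p : n.Partition) (S : Finset ℕ) ↦ (∀ j ∈ p.parts, ¬ k ∣ j) ∧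
        S ⊆ p.parts.toFinset ∧
        ∀ x ∈ S, (x : ZMod k) = (i : ZMod k) ∨ (x : ZMod k) = -(i : ZMod k))
  rw [hsum, Nat.Partition.restricted, card_filter, Nat.cast_sum, Nat.cast_sum]
  refine sum_congr rfl fun p _ ↦ ?_
  have two : (2 : ZMod 2) = 0 := by decide
  by_cases h : ∀ j ∈ p.parts, ¬ k ∣ j
  · rcases (A p).eq_empty_or_nonempty with hA | hA
    · rw [if_pos h, hA, if_pos]
      · simp
      · rw [filter_eq_empty_iff] at hA
        intro a ha
        have := hA (Multiset.mem_toFinset.2 ha)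
        have := h a ha
        tauto
    · rw [if_pos h, if_neg]
      · simp [two, hA.card_ne_zero]
      · obtain ⟨a, ha⟩ := hA
        rw [mem_filter, Multiset.mem_toFinset] at ha
        exact fun H ↦ H a ha.1 (Or.inr ha.2)
  · rw [if_neg h, if_neg]
    exact fun H ↦ h fun a ha hk ↦ H a ha (Or.inl hk)

theorem natCast_singularOverpartition_zero (k i : ℕ) :
    (singularOverpartition k i 0 : ZMod 2) = 1 := by
  simp [natCast_singularOverpartition_eq_card_restricted, Nat.Partition.restricted]

theorem dvd_or_natCast_eq_iff {k i a : ℕ} (hi : 1 ≤ i) (hik : 2 * i < k) (ha : 0 < a)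
    (hak : a ≤ k) (N : ℕ) :
    (k ∣ k * N + a ∨ ((k * N + a : ℕ) : ZMod k) = (i : ZMod k) ∨
      ((k * N + a : ℕ) : ZMod k) = -(i : ZMod k)) ↔ a = k ∨ a = i ∨ a = k - i := by
  have hneg : -(i : ZMod k) = ((k - i : ℕ) : ZMod k) := by
    rw [Nat.cast_sub (by omega), ZMod.natCast_self, zero_sub]
  have hcast : ((k * N + a : ℕ) : ZMod k) = (a : ZMod k) := by simp
  have hdvd : k ∣ a ↔ a = k :=
    ⟨fun h ↦ le_antisymm hak (Nat.le_of_dvd ha h), fun h ↦ h ▸ dvd_rfl⟩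
  have heq : ∀ b, 0 < b → b < k → (((a : ZMod k) = (b : ZMod k)) ↔ a = b) := by
    intro b hb hbk
    rw [ZMod.natCast_eq_natCast_iff, Nat.ModEq, Nat.mod_eq_of_lt hbk]
    rcases hak.eq_or_lt with rfl | hak
    · rw [Nat.mod_self]
      omega
    · rw [Nat.mod_eq_of_lt hak]
  rw [hneg, hcast, Nat.dvd_add_right (dvd_mul_right k N), hdvd, heq i hi (by omega),
    heq (k - i) (by omega) (by omega)]

open Classical in
theorem prod_ite_one_sub_X_pow_eq {R : Type*} [CommRing R] {k i : ℕ} (hi : 1 ≤ i)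
    (hik : 2 * i < k) (N : ℕ) :
    ∏ a ∈ range (k * N), (if (k ∣ a + 1 ∨ ((a + 1 : ℕ) : ZMod k) = (i : ZMod k) ∨
        ((a + 1 : ℕ) : ZMod k) = -(i : ZMod k)) then (1 : R⟦X⟧) - X ^ (a + 1) else 1) =
      qFactor (X ^ k) N *
        ∏ j ∈ range N, ((1 - X ^ (k * j + i)) * (1 - X ^ (k * j + (k - i)))) := by
  rw [qFactor, ← prod_mul_distrib]
  induction N with
  | zero => simp
  | succ N ih =>
    rw [mul_add, mul_one, prod_range_add, ih, prod_range_succ]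
    congr 1
    simp only [add_assoc]
    rw [prod_congr rfl fun r hr ↦ if_congr (dvd_or_natCast_eq_iff hi hik (Nat.succ_pos r)
      (Nat.succ_le_of_lt (mem_range.1 hr)) N) rfl rfl, ← prod_filter]
    have hset : (range k).filter (fun r ↦ r + 1 = k ∨ r + 1 = i ∨ r + 1 = k - i) =
        {k - 1, i - 1, k - i - 1} := by
      ext r
      simp only [mem_filter, mem_range, mem_insert, mem_singleton]
      omega
    simp only [Nat.succ_eq_add_one]
    rw [hset, prod_insert (by simp; omega), prod_insert (by simp; omega), prod_singleton,
      Nat.sub_add_cancel (by omega), Nat.sub_add_cancel hi, Nat.sub_add_cancel (by omega)]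
    ring

open PowerSeries.WithPiTopology in
theorem coeff_pentagonalSeries_mul_singularOverpartition {k i t : ℕ} (hi : 1 ≤ i)
    (hik : 2 * i < k) (h : ∀ m : ℤ, 2 * (t : ℤ) ≠ k * m ^ 2 - m * (k - 2 * i)) :
    coeff t ((PowerSeries.mk fun n ↦ (singularOverpartition k i n : ZMod 2)) *
      pentagonalSeries (ZMod 2)) = 0 := by
  classical
  set p : ℕ → Prop := fun a ↦
    ¬ (k ∣ a ∨ (a : ZMod k) = (i : ZMod k) ∨ (a : ZMod k) = -(i : ZMod k)) with hp
  have hprod := (Nat.Partition.hasProd_powerSeriesMk_card_restricted (ZMod 2) p).mul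
    (hasProd_one_sub_X_pow (ZMod 2))
  simp only [natCast_singularOverpartition_eq_card_restricted]
  have hfactor : ∀ a : ℕ, (if p (a + 1) then ∑' j : ℕ, (X : (ZMod 2)⟦X⟧) ^ ((a + 1) * j) else 1) *
      (1 - X ^ (a + 1)) = if (k ∣ a + 1 ∨ ((a + 1 : ℕ) : ZMod k) = (i : ZMod k) ∨
        ((a + 1 : ℕ) : ZMod k) = -(i : ZMod k)) then 1 - X ^ (a + 1) else 1 := by
    intro a
    simp only [hp, ite_not, ite_mul, one_mul]
    refine if_congr Iff.rfl rfl ?_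
    simp only [pow_mul]
    exact tsum_pow_mul_one_sub_of_constantCoeff_eq_zero (by simp)
  simp only [hfactor] at hprod
  rw [HasProd, tendsto_iff_coeff_tendsto] at hprod
  have hlim := (hprod t).comp (Filter.tendsto_finset_range.comp
    (Filter.tendsto_id.const_mul_atTop' (show 0 < k by omega)))
  refine tendsto_nhds_unique hlim (tendsto_const_nhds.congr' ?_)
  filter_upwards [Filter.eventually_gt_atTop (2 * t)] with N hN
  have hsign : ∀ x : (ZMod 2)⟦X⟧, 1 - x = 1 + x := fun x ↦ by
    ext
    simp [CharTwo.sub_eq_add]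
  simp only [Function.comp_apply, id, prod_ite_one_sub_X_pow_eq hi hik]
  rw [prod_congr rfl fun j _ ↦ by rw [hsign (X ^ (k * j + i)), hsign (X ^ (k * j + (k - i)))]]
  exact (coeff_qFactor_mul_prod_eq_zero hi hik hN h).symm

theorem sum_coeff_pentagonalSeries_eq_one (ℓ : ℕ) :
    ∑ a ∈ range (pentagonal (-ℓ) + 1), coeff a (pentagonalSeries (ZMod 2)) = 1 := by
  have hodd : ∀ z : ℤ, coeff (pentagonal z) (pentagonalSeries (ZMod 2)) = 1 := by
    intro z
    rw [coeff_pentagonalSeries_pentagonal]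
    rcases Int.even_or_odd z with hz | hz <;> simp [Int.negOnePow_even, Int.negOnePow_odd, hz]
  have hsub : (Icc (-ℓ : ℤ) ℓ).image pentagonal ⊆ range (pentagonal (-ℓ) + 1) := by
    intro a ha
    obtain ⟨z, hz, rfl⟩ := mem_image.1 ha
    rw [mem_Icc] at hz
    have h1 := two_mul_natCast_pentagonal z
    have h2 := two_mul_natCast_pentagonal_neg ℓ
    rw [mem_range]
    zify
    nlinarith
  rw [← sum_subset hsub, sum_image pentagonal_injective.injOn, sum_congr rfl fun z _ ↦ hodd z]
  · have two : (2 : ZMod 2) = 0 := by decide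
    have hcard : #(Icc (-ℓ : ℤ) ℓ) = 2 * ℓ + 1 := by
      rw [Int.card_Icc]
      omega
    simp [hcard, two]
  · intro a ha ha'
    refine coeff_pentagonalSeries_eq_zero _ ?_
    rintro ⟨z, rfl⟩
    refine ha' (mem_image_of_mem _ (mem_Icc.2 ?_))
    have h1 := two_mul_natCast_pentagonal z
    have h2 := two_mul_natCast_pentagonal_neg ℓ
    rw [mem_range, Nat.lt_succ_iff] at ha
    zify at ha
    constructor
    · by_contra! hz
      nlinarith
    · by_contra! hz
      nlinarith

end Parity

theorem stmt_7 (k i : ℕ) (hk : 3 ≤ k) (hi : 1 ≤ i) (hik : 2 * i < k)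
    (ℓ : ℕ) (hℓ : 2 ≤ ℓ)
    (h : ∀ m : ℕ, 0 < m →
      (ℓ : ℤ) * (3 * ℓ + 1) ≠ (k : ℤ) * m ^ 2 + m * ((k : ℤ) - 2 * i) ∧
      (ℓ : ℤ) * (3 * ℓ + 1) ≠ (k : ℤ) * m ^ 2 - m * ((k : ℤ) - 2 * i)) :
    ∃ n : ℕ, ℓ ≤ n ∧ n ≤ ℓ * (3 * ℓ + 1) / 2 ∧ Even (singularOverpartition k i n) := by
  by_contra! hodd
  set t := pentagonal (-ℓ) with ht
  have h2t : 2 * (t : ℤ) = ℓ * (3 * ℓ + 1) := two_mul_natCast_pentagonal_neg ℓ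
  have htdiv : t = ℓ * (3 * ℓ + 1) / 2 := by
    zify
    omega
  have hne : ∀ m : ℤ, 2 * (t : ℤ) ≠ k * m ^ 2 - m * (k - 2 * i) := by
    intro m
    rw [h2t]
    rcases lt_trichotomy m 0 with hm | rfl | hm
    · obtain ⟨n, rfl⟩ := Int.eq_negSucc_of_lt_zero hm
      have := (h (n + 1) n.succ_pos).1
      rw [Int.negSucc_eq]
      contrapose! this
      push_cast
      linear_combination this
    · have : (2 : ℤ) ≤ ℓ := by exact_mod_cast hℓ
      rw [show (k : ℤ) * 0 ^ 2 - 0 * (k - 2 * i) = 0 by ring]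
      positivity
    · lift m to ℕ using hm.le
      exact (h m (by exact_mod_cast hm)).2
  have hcoeff : ∀ a ∈ range (t + 1), (singularOverpartition k i (t - a) : ZMod 2) *
      coeff a (pentagonalSeries (ZMod 2)) = coeff a (pentagonalSeries (ZMod 2)) := by
    intro a ha
    rw [mem_range, Nat.lt_succ_iff] at ha
    by_cases hz : a ∈ Set.range pentagonal
    · obtain ⟨z, rfl⟩ := hz
      suffices (singularOverpartition k i (t - pentagonal z) : ZMod 2) = 1 by rw [this, one_mul]
      have h2z := two_mul_natCast_pentagonal z
      zify at ha
      rcases eq_or_ne z (-ℓ) with rfl | hzℓ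
      · rw [ht, Nat.sub_self, natCast_singularOverpartition_zero]
      · have hlow : -(ℓ : ℤ) + 1 ≤ z := by
          by_contra! hz
          have : z + 1 ≤ -(ℓ : ℤ) := by omega
          nlinarith
        have hupp : z ≤ ℓ := by
          by_contra! hz
          nlinarith
        have hgap : (ℓ : ℤ) ≤ t - pentagonal z := by nlinarith
        rw [ZMod.natCast_eq_one_iff_odd, ← Nat.not_even_iff_odd]
        exact hodd _ (by omega) (by omega)
    · rw [coeff_pentagonalSeries_eq_zero _ hz, mul_zero]
  have hzero := coeff_pentagonalSeries_mul_singularOverpartition hi hik hne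
  rw [mul_comm, coeff_mul, Nat.sum_antidiagonal_eq_sum_range_succ_mk] at hzero
  simp only [coeff_mk, mul_comm (coeff _ _)] at hzero
  rw [sum_congr rfl hcoeff, ht, sum_coeff_pentagonalSeries_eq_one] at hzero
  exact one_ne_zero hzero
end

section
/- Let p ≥ 5 be a prime and let ℓ ≥ 2 be an integer with ℓ ≡ 2 (mod 3). Then there exists an integer n with 2ℓ−1 ≤ n ≤ ℓ(3ℓ−1)/2 such that C̄_{p,1}(n) is odd. -/
open Finset PowerSeries

/-- The `q`-Pochhammer product `(1 - q) (1 - q ^ 2) ⋯ (1 - q ^ n)`. -/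
def qPochhammer {R : Type*} [CommRing R] (q : R) (n : ℕ) : R :=
  ∏ i ∈ range n, (1 - q ^ (i + 1))

/-- The Gaussian binomial coefficient, defined by the `q`-Pascal recursion. -/
def gaussianBinomial {R : Type*} [CommRing R] (q : R) : ℕ → ℕ → R
  | _, 0 => 1
  | 0, _ + 1 => 0
  | n + 1, k + 1 => gaussianBinomial q n k + q ^ (k + 1) * gaussianBinomial q n (k + 1)

section CommRing

variable {R : Type*} [CommRing R]

lemma qPochhammer_succ (q : R) (n : ℕ) :
    qPochhammer q (n + 1) = qPochhammer q n * (1 - q ^ (n + 1)) :=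
  prod_range_succ _ _

@[simp]
lemma gaussianBinomial_zero_right (q : R) (n : ℕ) : gaussianBinomial q n 0 = 1 := by
  cases n <;> rfl

lemma gaussianBinomial_succ_succ (q : R) (n k : ℕ) :
    gaussianBinomial q (n + 1) (k + 1) =
      gaussianBinomial q n k + q ^ (k + 1) * gaussianBinomial q n (k + 1) :=
  rfl

lemma gaussianBinomial_eq_zero_of_lt (q : R) {n k : ℕ} (h : n < k) :
    gaussianBinomial q n k = 0 := by
  induction n generalizing k with
  | zero => obtain ⟨k, rfl⟩ := Nat.exists_eq_add_one_of_ne_zero h.ne'; rfl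
  | succ n ih =>
    obtain ⟨k, rfl⟩ := Nat.exists_eq_add_one_of_ne_zero (Nat.ne_zero_of_lt h)
    rw [gaussianBinomial_succ_succ, ih (by lia), ih (by lia)]
    simp

lemma gaussianBinomial_self (q : R) (n : ℕ) : gaussianBinomial q n n = 1 := by
  induction n with
  | zero => rfl
  | succ n ih =>
    rw [gaussianBinomial_succ_succ, ih, gaussianBinomial_eq_zero_of_lt q n.lt_succ_self]
    simp

lemma gaussianBinomial_mul_qPochhammer (q : R) (a b : ℕ) :
    gaussianBinomial q (a + b) a * qPochhammer q a * qPochhammer q b = qPochhammer q (a + b) := by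
  induction a generalizing b with
  | zero => simp [qPochhammer]
  | succ a iha =>
    induction b with
    | zero => simp [gaussianBinomial_self, qPochhammer]
    | succ b ihb =>
      have h := iha (b + 1)
      rw [show a + 1 + (b + 1) = a + (b + 1) + 1 by ring, gaussianBinomial_succ_succ,
        qPochhammer_succ q (a + (b + 1)), ← h]
      rw [show a + 1 + b = a + (b + 1) by ring, ← h] at ihb
      rw [qPochhammer_succ q a, qPochhammer_succ q b] at *
      linear_combination q ^ (a + 1) * (1 - q ^ (b + 1)) * ihb

/-- Homogeneous form of the `q`-binomial theorem. -/
lemma prod_add_mul_pow_eq_sum_gaussianBinomial (q x y : R) (n : ℕ) :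
    ∏ j ∈ range n, (y + x * q ^ j) =
      ∑ k ∈ range (n + 1), q ^ k.choose 2 * gaussianBinomial q n k * x ^ k * y ^ (n - k) := by
  induction n generalizing x with
  | zero => simp
  | succ n ih =>
    have h := ih (x * q)
    rw [prod_range_succ']
    simp_rw [pow_succ', ← mul_assoc]
    rw [h, sum_range_succ' _ (n + 1)]
    simp_rw [gaussianBinomial_succ_succ]
    have hsplit : ∀ k ∈ range (n + 1),
        q ^ (k + 1).choose 2 * (gaussianBinomial q n k +
          q ^ (k + 1) * gaussianBinomial q n (k + 1)) * x ^ (k + 1) * y ^ (n + 1 - (k + 1)) =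
        x * (q ^ k.choose 2 * gaussianBinomial q n k * (x * q) ^ k * y ^ (n - k)) +
        q ^ (k + 1).choose 2 * gaussianBinomial q n (k + 1) * (x * q) ^ (k + 1) *
          y ^ (n - k) := by
      intro k _
      rw [show (k + 1).choose 2 = k + k.choose 2 by simp [Nat.choose_succ_succ' k 1],
        Nat.add_sub_add_right]
      ring
    have hshift : ∑ k ∈ range (n + 1),
        q ^ (k + 1).choose 2 * gaussianBinomial q n (k + 1) * (x * q) ^ (k + 1) * y ^ (n - k) +
          y ^ (n + 1) =
        y * ∑ k ∈ range (n + 1),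
          q ^ k.choose 2 * gaussianBinomial q n k * (x * q) ^ k * y ^ (n - k) := by
      rw [sum_range_succ, gaussianBinomial_eq_zero_of_lt q n.lt_succ_self,
        sum_range_succ' _ n, mul_add, mul_sum]
      simp only [mul_zero, zero_mul, add_zero]
      congr 1
      · refine sum_congr rfl fun k hk ↦ ?_
        rw [mem_range] at hk
        rw [show n - k = n - (k + 1) + 1 by lia]
        ring
      · simp [pow_succ']
    rw [sum_congr rfl hsplit, sum_add_distrib, ← mul_sum]
    simp only [Nat.choose_zero_succ, pow_zero, gaussianBinomial_zero_right, Nat.sub_zero,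
      mul_one, one_mul]
    linear_combination -hshift

lemma pow_dvd_qPochhammer_sub (q : R) {r n : ℕ} (h : r ≤ n) :
    q ^ (r + 1) ∣ qPochhammer q n - qPochhammer q r := by
  induction n, h using Nat.le_induction with
  | base => simp
  | succ n hn ih =>
    rw [qPochhammer_succ, show qPochhammer q n * (1 - q ^ (n + 1)) - qPochhammer q r =
      qPochhammer q n - qPochhammer q r - qPochhammer q n * q ^ (n + 1) by ring]
    exact dvd_sub ih (Dvd.dvd.mul_left (pow_dvd_pow q (by lia)) _)

lemma pow_dvd_gaussianBinomial_mul_qPochhammer_sub_one (q : R)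
    (hq : ∀ n, IsUnit (qPochhammer q n)) {a b r m : ℕ} (ha : r ≤ a) (hb : r ≤ b) (hm : r ≤ m) :
    q ^ (r + 1) ∣ gaussianBinomial q (a + b) a * qPochhammer q m - 1 := by
  obtain ⟨u, hu⟩ := pow_dvd_qPochhammer_sub q ha
  obtain ⟨v, hv⟩ := pow_dvd_qPochhammer_sub q hb
  obtain ⟨w, hw⟩ := pow_dvd_qPochhammer_sub q hm
  obtain ⟨t, ht⟩ := pow_dvd_qPochhammer_sub q (ha.trans (Nat.le_add_right a b))
  have h := gaussianBinomial_mul_qPochhammer q a b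
  rw [← (hq r).dvd_mul_left]
  rw [sub_eq_iff_eq_add] at hu hv hw ht
  rw [hu, hv, ht] at h
  rw [hw]
  set g := gaussianBinomial q (a + b) a
  refine ⟨t + g * qPochhammer q r * w - g * u * qPochhammer q r - g * v * qPochhammer q r
    - g * u * v * q ^ (r + 1), ?_⟩
  linear_combination h

lemma isUnit_qPochhammer_X_pow {p : ℕ} (hp : p ≠ 0) (n : ℕ) :
    IsUnit (qPochhammer ((X : R⟦X⟧) ^ p) n) := by
  rw [isUnit_iff_constantCoeff]
  simp [qPochhammer, hp]

lemma prod_range_add_self_pow_add_mul_pow (q x : R) (m : ℕ) :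
    ∏ j ∈ range (m + m), (q ^ m + x * q ^ j) =
      q ^ (m * m + m.choose 2) *
        ((∏ j ∈ range m, (1 + x * q ^ j)) * ∏ j ∈ range m, (q ^ (j + 1) + x)) := by
  have hlow : ∏ j ∈ range m, (q ^ m + x * q ^ j) =
      q ^ m.choose 2 * ∏ j ∈ range m, (q ^ (j + 1) + x) := by
    rw [Nat.choose_two_right, ← sum_range_id, ← prod_pow_eq_pow_sum,
      ← prod_range_reflect (fun j ↦ q ^ (j + 1) + x), ← prod_mul_distrib]
    refine prod_congr rfl fun j hj ↦ ?_
    rw [mem_range] at hj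
    rw [mul_add, ← pow_add, show j + (m - 1 - j + 1) = m by lia]
    ring
  have hhigh : ∏ j ∈ range m, (q ^ m + x * q ^ (m + j)) =
      q ^ (m * m) * ∏ j ∈ range m, (1 + x * q ^ j) := by
    rw [pow_mul, show (q ^ m) ^ m = ∏ _j ∈ range m, q ^ m by simp, ← prod_mul_distrib]
    exact prod_congr rfl fun j _ ↦ by ring
  rw [prod_range_add, hlow, hhigh, pow_add]
  ring

lemma X_pow_mul_prod_one_add_X_pow {p : ℕ} (hp : p ≠ 0) (m : ℕ) :
    (X : R⟦X⟧) ^ (p * (m * m + m.choose 2) + m) *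
        ∏ j ∈ range m, ((1 + X ^ (p * j + 1)) * (1 + X ^ (p * j + (p - 1)))) =
      ∑ k ∈ range (m + m + 1), gaussianBinomial (X ^ p) (m + m) k *
        X ^ (p * k.choose 2 + k + p * m * (m + m - k)) := by
  have h := prod_add_mul_pow_eq_sum_gaussianBinomial ((X : R⟦X⟧) ^ p) X ((X ^ p) ^ m) (m + m)
  rw [prod_range_add_self_pow_add_mul_pow] at h
  have hX : ∏ j ∈ range m, (((X : R⟦X⟧) ^ p) ^ (j + 1) + X) =
      X ^ m * ∏ j ∈ range m, (1 + X ^ (p * j + (p - 1))) := by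
    rw [show (X : R⟦X⟧) ^ m = ∏ _j ∈ range m, X by simp, ← prod_mul_distrib]
    refine prod_congr rfl fun j _ ↦ ?_
    rw [mul_add, ← pow_succ', ← pow_mul, show p * (j + 1) = p * j + (p - 1) + 1 by
      rw [mul_add]; lia]
    ring
  rw [hX] at h
  rw [prod_mul_distrib]
  calc _ = (X ^ p) ^ (m * m + m.choose 2) * ((∏ j ∈ range m, (1 + X * (X ^ p) ^ j)) *
      (X ^ m * ∏ j ∈ range m, (1 + X ^ (p * j + (p - 1))))) := by
        simp_rw [← pow_mul, ← pow_succ']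
        ring
    _ = _ := h.trans <| sum_congr rfl fun k _ ↦ by
        simp_rw [← pow_mul, pow_add]
        ring

end CommRing

lemma two_mul_cast_choose_two (n : ℕ) : 2 * (n.choose 2 : ℤ) = n * (n - 1) := by
  have h := sum_range_id_mul_two n
  rw [sum_range_id, ← Nat.choose_two_right] at h
  cases n with
  | zero => simp
  | succ n =>
    push_cast
    zify at h
    simp at h
    linarith

lemma theta_exponent_add_lt {p : ℕ} (hp : 2 ≤ p) {a b m : ℕ} (hab : a + b = m + m) :
    p * (m * m + m.choose 2) + m + m <
      p * a.choose 2 + a + p * m * b + p * (min a (min b m) + 1) := by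
  have ha := two_mul_cast_choose_two a
  have hm := two_mul_cast_choose_two m
  rcases le_total a m with h | h
  · obtain ⟨j, rfl⟩ := Nat.exists_eq_add_of_le h
    obtain rfl : b = a + 2 * j := by lia
    rw [show min a (min (a + 2 * j) (a + j)) = a by lia]
    zify at hp ⊢
    push_cast at hm
    have hj : (0 : ℤ) ≤ (p - 2) * (j ^ 2 + j + 2 * a + 2) :=
      mul_nonneg (by linarith) (by positivity)
    nlinarith [sq_nonneg ((j : ℤ) - 1)]
  · obtain ⟨j, rfl⟩ : ∃ j, m = b + j := Nat.exists_eq_add_of_le (by lia)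
    obtain rfl : a = b + 2 * j := by lia
    rw [show min (b + 2 * j) (min b (b + j)) = b by lia]
    zify at hp ⊢
    push_cast at ha hm
    have hjj : (0 : ℤ) ≤ j ^ 2 - j := by
      rcases j.eq_zero_or_pos with rfl | h0
      · simp
      · zify at h0
        nlinarith
    have hj : (0 : ℤ) ≤ (p - 2) * (j ^ 2 - j + 2 * b + 2) :=
      mul_nonneg (by linarith) (by positivity)
    nlinarith

lemma coeff_prod_mul_qPochhammer_eq_zero {R : Type*} [CommRing R] {p : ℕ} (hp : 2 ≤ p) {m N : ℕ}
    (hNm : N ≤ m)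
    (hN : ∀ a b, a + b = m + m →
      p * a.choose 2 + a + p * m * b ≠ p * (m * m + m.choose 2) + m + N) :
    coeff N ((∏ j ∈ range m, ((1 + (X : R⟦X⟧) ^ (p * j + 1)) * (1 + X ^ (p * j + (p - 1))))) *
      qPochhammer (X ^ p) m) = 0 := by
  have hp0 : p ≠ 0 := by lia
  rw [← coeff_X_pow_mul _ (p * (m * m + m.choose 2) + m), ← mul_assoc,
    X_pow_mul_prod_one_add_X_pow hp0, sum_mul, map_sum]
  refine sum_eq_zero fun k hk ↦ ?_
  rw [mem_range] at hk
  obtain ⟨b, hb⟩ := Nat.exists_eq_add_of_le (Nat.lt_succ_iff.mp hk)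
  obtain ⟨h, hh⟩ := pow_dvd_gaussianBinomial_mul_qPochhammer_sub_one ((X : R⟦X⟧) ^ p)
    (isUnit_qPochhammer_X_pow hp0) (a := k) (b := b) (r := min k (min b m)) (m := m)
    (by simp) (by simp) (by simp)
  have hlt := theta_exponent_add_lt hp hb.symm
  have hne := hN k b hb.symm
  rw [hb, Nat.add_sub_cancel_left, mul_right_comm, sub_eq_iff_eq_add.mp hh, add_mul, one_mul,
    mul_right_comm, ← pow_mul, ← pow_add, map_add, coeff_X_pow_mul', coeff_X_pow,
    if_neg (by lia), if_neg (by lia), add_zero]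

/-- The pentagonal number `pentagonal ℓ` exceeds the preceding one by `2 * ℓ - 1`. -/
lemma pentagonal_add_two_mul_sub_one_le {ℓ k : ℤ} (hℓ : 0 < ℓ)
    (h : pentagonal k < pentagonal ℓ) : (pentagonal k : ℤ) + (2 * ℓ - 1) ≤ pentagonal ℓ := by
  have hk := two_mul_natCast_pentagonal k
  have hℓ' := two_mul_natCast_pentagonal ℓ
  zify at h
  have hk1 : k < ℓ := by
    by_contra! hle
    nlinarith
  have hk2 : 1 - ℓ ≤ k := by
    by_contra! hle
    nlinarith
  nlinarith

lemma theta_exponent_ne {p ℓ m N a b : ℕ} (hp : ¬ 3 ∣ p) (hℓ : ℓ % 3 = 2)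
    (hN : 2 * (N : ℤ) = ℓ * (3 * ℓ - 1)) (hab : a + b = m + m) :
    p * a.choose 2 + a + p * m * b ≠ p * (m * m + m.choose 2) + m + N := by
  intro h
  have ha := two_mul_cast_choose_two a
  have hm := two_mul_cast_choose_two m
  zify at h hab
  obtain ⟨s, hs⟩ : ∃ s : ℤ, (a : ℤ) = m + s := ⟨a - m, by ring⟩
  have hb : (b : ℤ) = m - s := by linarith
  have key : (p : ℤ) * (s * (s - 1)) + 2 * s = ℓ * (3 * ℓ - 1) := by
    rw [hb] at h
    rw [hs] at ha h
    linear_combination 2 * h + hN - p * ha + p * hm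
  have hp' : (p : ℤ) % 3 ≠ 0 := by lia
  have hℓ' : (ℓ : ℤ) % 3 = 2 := by lia
  have hmod := congrArg (· % 3) key
  rcases (by lia : (p : ℤ) % 3 = 1 ∨ (p : ℤ) % 3 = 2) with hp1 | hp1 <;>
  rcases (by lia : s % 3 = 0 ∨ s % 3 = 1 ∨ s % 3 = 2) with hs1 | hs1 | hs1 <;>
  simp [Int.add_emod, Int.sub_emod, Int.mul_emod, hp1, hs1, hℓ'] at hmod

/-- A part that may occur in a partition counted by `singularOverpartition k i`, but not be
overlined. -/
abbrev IsPlainPart (k i j : ℕ) : Prop :=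
  ¬ k ∣ j ∧ ¬ ((j : ZMod k) = (i : ZMod k) ∨ (j : ZMod k) = -(i : ZMod k))

lemma natCast_singularOverpartition_zmod_two (k i n : ℕ) :
    (singularOverpartition k i n : ZMod 2) =
      (#(Nat.Partition.restricted n (IsPlainPart k i)) : ZMod 2) := by
  have hcard : singularOverpartition k i n =
      #((({P : n.Partition | ∀ j ∈ P.parts, ¬ k ∣ j} : Finset _).sigma fun P ↦
        {x ∈ (P : n.Partition).parts.toFinset | ((x : ℕ) : ZMod k) = (i : ZMod k) ∨
          (x : ZMod k) = -(i : ZMod k)}.powerset).map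
            (Equiv.sigmaEquivProd n.Partition (Finset ℕ)).toEmbedding) := by
    refine Nat.subtype_card _ fun ⟨P, S⟩ ↦ ?_
    simp [Equiv.sigmaEquivProd, subset_iff]
    grind
  rw [hcard, card_map, card_sigma, Nat.cast_sum, Nat.Partition.restricted, card_filter,
    Nat.cast_sum, sum_filter]
  refine sum_congr rfl fun P _ ↦ ?_
  rw [card_powerset, Nat.cast_pow, Nat.cast_ofNat, show (2 : ZMod 2) = 0 from rfl]
  simp only [zero_pow_eq, card_eq_zero, filter_eq_empty_iff, Multiset.mem_toFinset]
  rw [Nat.cast_ite]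
  simp only [Nat.cast_one, Nat.cast_zero, IsPlainPart]
  grind

lemma prod_range_mul_add_one {M : Type*} [CommMonoid M] (g : ℕ → M) (p m : ℕ) :
    ∏ i ∈ range (p * m), g (i + 1) = ∏ j ∈ range m, ∏ c ∈ range p, g (p * j + c + 1) := by
  induction m with
  | zero => simp
  | succ m ih => rw [mul_add_one, prod_range_add, ih, prod_range_succ]

lemma isPlainPart_one_iff {p j c : ℕ} (hp : 3 ≤ p) (hc : c < p) :
    IsPlainPart p 1 (p * j + c + 1) ↔ c ≠ 0 ∧ c + 2 ≠ p ∧ c + 1 ≠ p := by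
  have hone : ((p * j + c + 1 : ℕ) : ZMod p) = ((1 : ℕ) : ZMod p) ↔ c = 0 := by
    rw [ZMod.natCast_eq_natCast_iff', add_assoc, Nat.mul_add_mod, ← ZMod.natCast_eq_natCast_iff']
    push_cast
    rw [add_eq_right, ZMod.natCast_eq_zero_iff]
    exact ⟨fun h ↦ Nat.eq_zero_of_dvd_of_lt h hc, fun h ↦ h ▸ dvd_zero p⟩
  have hneg : ((p * j + c + 1 : ℕ) : ZMod p) = -((1 : ℕ) : ZMod p) ↔ c + 2 = p := by
    rw [← add_eq_zero_iff_eq_neg, ← Nat.cast_add, ZMod.natCast_eq_zero_iff, add_assoc, add_assoc,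
      Nat.dvd_add_right (dvd_mul_right p j)]
    exact ⟨fun h ↦ Nat.eq_of_dvd_of_lt_two_mul (by lia) h (by lia), fun h ↦ h ▸ dvd_rfl⟩
  have hzero : p ∣ p * j + c + 1 ↔ c + 1 = p := by
    rw [add_assoc, Nat.dvd_add_right (dvd_mul_right p j)]
    exact ⟨fun h ↦ Nat.eq_of_dvd_of_lt_two_mul (by lia) h (by lia), fun h ↦ h ▸ dvd_rfl⟩
  rw [IsPlainPart, hone, hneg, hzero]
  tauto

lemma prod_range_block_eq {R : Type*} [CommRing R] {p : ℕ} (hp : 3 ≤ p) (j : ℕ) :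
    ∏ c ∈ range p, (if IsPlainPart p 1 (p * j + c + 1) then 1 else
      1 - (X : R⟦X⟧) ^ (p * j + c + 1)) =
    (1 - X ^ (p * j + 1)) * (1 - X ^ (p * j + (p - 1))) * (1 - (X ^ p) ^ (j + 1)) := by
  simp_rw [prod_congr rfl fun c hc ↦ if_congr (isPlainPart_one_iff hp (mem_range.mp hc)) rfl rfl]
  obtain ⟨q, rfl⟩ := Nat.exists_eq_add_of_le' hp
  rw [prod_range_succ, prod_range_succ, prod_range_succ', prod_congr rfl (g := fun _ ↦ 1)
    fun c hc ↦ if_pos (by rw [mem_range] at hc; lia)]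
  simp [← pow_mul, mul_add_one, add_assoc]

open scoped PowerSeries.WithPiTopology in
lemma exists_coeff_restricted_mul_pentagonalSeries_eq {p : ℕ} (hp : 3 ≤ p) (N : ℕ) :
    ∃ m ≥ N, coeff N (PowerSeries.mk (fun n ↦
        (#(Nat.Partition.restricted n (IsPlainPart p 1)) : ZMod 2)) * pentagonalSeries (ZMod 2)) =
      coeff N ((∏ j ∈ range m, ((1 + (X : (ZMod 2)⟦X⟧) ^ (p * j + 1)) *
        (1 + X ^ (p * j + (p - 1))))) * qPochhammer (X ^ p) m) := by
  let _ : TopologicalSpace (ZMod 2) := ⊥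
  have _ : DiscreteTopology (ZMod 2) := ⟨rfl⟩
  have h := (Nat.Partition.hasProd_powerSeriesMk_card_restricted (ZMod 2) (IsPlainPart p 1)).mul
    (WithPiTopology.hasProd_one_sub_X_pow (ZMod 2))
  have hfactor (i : ℕ) : (if IsPlainPart p 1 (i + 1) then
      ∑' j : ℕ, (X : (ZMod 2)⟦X⟧) ^ ((i + 1) * j) else 1) * (1 - X ^ (i + 1)) =
      if IsPlainPart p 1 (i + 1) then 1 else 1 - X ^ (i + 1) := by
    split_ifs
    · simp_rw [pow_mul]
      exact WithPiTopology.tsum_pow_mul_one_sub_of_constantCoeff_eq_zero (by simp)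
    · rw [one_mul]
  simp_rw [hfactor] at h
  have hlim := (WithPiTopology.tendsto_iff_coeff_tendsto _ _ _ _).mp h.tendsto_prod_nat N
  rw [nhds_discrete, Filter.tendsto_pure] at hlim
  obtain ⟨m, hm⟩ := Filter.eventually_atTop.mp hlim
  refine ⟨max m N, le_max_right _ _, ?_⟩
  rw [← hm (p * max m N) ((le_max_left m N).trans (Nat.le_mul_of_pos_left _ (by lia))),
    prod_range_mul_add_one (fun i ↦ if IsPlainPart p 1 i then 1 else 1 - (X : (ZMod 2)⟦X⟧) ^ i),
    prod_congr rfl fun j _ ↦ prod_range_block_eq hp j, prod_mul_distrib, qPochhammer]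
  have hsub (f : (ZMod 2)⟦X⟧) : 1 - f = 1 + f := by
    ext n
    simp [CharTwo.sub_eq_add]
  simp_rw [hsub]

theorem stmt_10 (p : ℕ) (hp : p.Prime) (hp5 : 5 ≤ p) (ℓ : ℕ) (hℓ : 2 ≤ ℓ) (hℓmod : ℓ % 3 = 2) :
    ∃ n : ℕ, 2 * ℓ - 1 ≤ n ∧ n ≤ ℓ * (3 * ℓ - 1) / 2 ∧ Odd (singularOverpartition p 1 n) := by
  have hp3 : ¬ 3 ∣ p := fun h ↦ by
    have := (Nat.prime_dvd_prime_iff_eq Nat.prime_three hp).mp h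
    lia
  have hN := two_mul_natCast_pentagonal ℓ
  have hN' : pentagonal ℓ = ℓ * (3 * ℓ - 1) / 2 := by
    zify [show 1 ≤ 3 * ℓ by lia]
    exact natCast_pentagonal ℓ
  rw [← hN']
  by_contra! hcon
  obtain ⟨m, hm, hcoeff⟩ :=
    exists_coeff_restricted_mul_pentagonalSeries_eq (p := p) (by lia) (pentagonal ℓ)
  rw [coeff_prod_mul_qPochhammer_eq_zero (by lia) hm fun a b ↦ theta_exponent_ne hp3 hℓmod hN,
    coeff_mul, sum_eq_single (0, pentagonal ℓ)] at hcoeff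
  · simp [Nat.Partition.restricted] at hcoeff
  · rintro ⟨a, b⟩ hab hne
    rw [HasAntidiagonal.mem_antidiagonal] at hab
    dsimp only at hab
    rw [coeff_mk, ← natCast_singularOverpartition_zmod_two]
    clear hN hN'
    by_cases ha : 2 * ℓ - 1 ≤ a
    · have heven := hcon a ha (by lia)
      rw [Nat.not_odd_iff_even, even_iff_two_dvd, ← ZMod.natCast_eq_zero_iff] at heven
      rw [heven, zero_mul]
    · rw [coeff_pentagonalSeries_eq_zero, mul_zero]
      rintro ⟨k, rfl⟩
      have hlt : pentagonal k < pentagonal ℓ := by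
        refine lt_of_le_of_ne (by lia) fun h ↦ hne ?_
        rw [Prod.mk.injEq]
        lia
      have := pentagonal_add_two_mul_sub_one_le (by lia) hlt
      lia
  · simp
end
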